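/- The spectrum of the projected Laplacian 𝓛^{pr} on ℓ²(ℤ), defined by (𝓛^{pr}f)(m) = f(m) − (1/2)f(m−1) − (1/(2√2))f(m+1) for even m ≥ 0, (𝓛^{pr}f)(m) = (3/4)f(m) − (1/(2√2))f(m−1) − (1/2)f(m+1) for odd m ≥ 0, and symmetrically for negative arguments via m ↦ −m−1, is [λ₀, 7/4−λ₁] ∪ {3/4} ∪ [λ₁, 7/4−λ₀] ∪ {7/4}, where λ₀ = 7/8 − (1/2)√(25/16+√2) and λ₁ = 7/8 + (1/2)√(25/16−√2). -/

import Mathlib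

open Classical in
/-- Pointwise action of the projected normalized Laplacian `𝓛^{pr}` on `ℤ`:
for `m ≥ 0` the even/odd formulas, for negative arguments the formulas obtained
by the reflection symmetry `m ↦ -m-1`. -/
noncomputable def lprFunC (g : ℤ → ℂ) (m : ℤ) : ℂ :=
  if 0 ≤ m then
    if Even m then
      g m - (1/2) * g (m - 1) - ((1 / (2 * Real.sqrt 2) : ℝ) : ℂ) * g (m + 1)
    else
      (3/4) * g m - ((1 / (2 * Real.sqrt 2) : ℝ) : ℂ) * g (m - 1) - (1/2) * g (m + 1)
  else
    if Even (-m - 1) then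
      g m - (1/2) * g (m + 1) - ((1 / (2 * Real.sqrt 2) : ℝ) : ℂ) * g (m - 1)
    else
      (3/4) * g m - ((1 / (2 * Real.sqrt 2) : ℝ) : ℂ) * g (m + 1) - (1/2) * g (m - 1)

open Filter Topology

theorem exists_small_root (w : ℂ) (h : ∀ t : ℝ, |t| ≤ 2 → w ≠ t) :
    ∃ r : ℂ, r ≠ 0 ∧ ‖r‖ < 1 ∧ r ^ 2 + 1 = w * r := by
  obtain ⟨d, hd⟩ := IsAlgClosed.exists_pow_nat_eq (w ^ 2 - 4) (n := 2) (by norm_num)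
  have hz : ((w + d) / 2) ^ 2 + 1 = w * ((w + d) / 2) := by linear_combination hd / 4
  set z := (w + d) / 2
  have hz0 : z ≠ 0 := by rintro h0; simp [h0] at hz
  rcases lt_trichotomy ‖z‖ 1 with h1 | h1 | h1
  · exact ⟨z, hz0, h1, hz⟩
  · exfalso
    refine h (2 * z.re) ?_ ?_
    · rw [abs_mul, abs_two]
      have := Complex.abs_re_le_norm z
      linarith
    · have hc : z * (starRingEnd ℂ) z = 1 := by
        rw [Complex.mul_conj, Complex.normSq_eq_norm_sq, h1]; simp
      have hw : w = z + (starRingEnd ℂ) z := by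
        apply mul_right_cancel₀ hz0
        linear_combination -hz - hc
      rw [hw, Complex.add_conj]
  · refine ⟨z⁻¹, inv_ne_zero hz0, ?_, ?_⟩
    · rw [norm_inv]; exact inv_lt_one_of_one_lt₀ h1
    · field_simp
      linear_combination hz

theorem memℓp_two_iff {ι : Type*} {f : ι → ℂ} : Memℓp f 2 ↔ Summable fun i => ‖f i‖ ^ 2 := by
  rw [memℓp_gen_iff (by norm_num)]
  simp

theorem Memℓp.nat_succ {f : ℕ → ℂ} (h : Memℓp f 2) : Memℓp (fun k => f (k + 1)) 2 := by
  rw [memℓp_two_iff] at *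
  exact (summable_nat_add_iff 1).2 h

theorem Memℓp.of_nat_succ {f : ℕ → ℂ} (h : Memℓp (fun k => f (k + 1)) 2) : Memℓp f 2 := by
  rw [memℓp_two_iff] at *
  exact (summable_nat_add_iff 1).1 h

theorem Memℓp.tendsto_nat {f : ℕ → ℂ} (h : Memℓp f 2) : Tendsto f atTop (𝓝 0) := by
  rw [memℓp_two_iff] at h
  rw [tendsto_zero_iff_norm_tendsto_zero]
  have := h.tendsto_atTop_zero.sqrt
  simpa using this

theorem norm_add_mul_sq_le {r x y : ℂ} (hr : ‖r‖ < 1) :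
    ‖x + r * y‖ ^ 2 ≤ ‖r‖ * ‖y‖ ^ 2 + ‖x‖ ^ 2 / (1 - ‖r‖) := by
  have h1 : ‖x + r * y‖ ≤ ‖x‖ + ‖r‖ * ‖y‖ := by
    simpa using norm_add_le x (r * y)
  have h2 : 0 < 1 - ‖r‖ := by linarith
  have h3 := norm_nonneg r
  calc ‖x + r * y‖ ^ 2 ≤ (‖x‖ + ‖r‖ * ‖y‖) ^ 2 := by gcongr
    _ ≤ _ := by
      rw [← sub_nonneg]
      have : ‖r‖ * ‖y‖ ^ 2 + ‖x‖ ^ 2 / (1 - ‖r‖) - (‖x‖ + ‖r‖ * ‖y‖) ^ 2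
          = ‖r‖ * (‖x‖ - (1 - ‖r‖) * ‖y‖) ^ 2 / (1 - ‖r‖) := by
        field_simp
        ring
      rw [this]
      positivity

theorem exists_forward {r : ℂ} (hr : ‖r‖ < 1) {y : ℕ → ℂ} (hy : Memℓp y 2) :
    ∃ u : ℕ → ℂ, Memℓp u 2 ∧ u 0 = y 0 ∧ ∀ k, u (k + 1) = y (k + 1) + r * u k := by
  let u : ℕ → ℂ := fun n => Nat.rec (y 0) (fun k x => y (k + 1) + r * x) n
  refine ⟨u, ?_, rfl, fun k => rfl⟩
  rw [memℓp_two_iff] at *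
  have h2 : 0 < 1 - ‖r‖ := by linarith
  have key : ∀ n, (1 - ‖r‖) * ∑ k ∈ Finset.range n, ‖u k‖ ^ 2 + ‖u n‖ ^ 2 ≤
      ‖u 0‖ ^ 2 + (∑ k ∈ Finset.range n, ‖y (k + 1)‖ ^ 2) / (1 - ‖r‖) := by
    intro n
    induction n with
    | zero => simp
    | succ n ih =>
      have : ‖u (n + 1)‖ ^ 2 ≤ _ := norm_add_mul_sq_le (x := y (n + 1)) (y := u n) hr
      rw [Finset.sum_range_succ, Finset.sum_range_succ, add_div]
      linarith
  have hy' : Summable fun k => ‖y (k + 1)‖ ^ 2 := (summable_nat_add_iff 1).2 hy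
  refine summable_of_sum_range_le
    (c := (‖u 0‖ ^ 2 + (∑' k, ‖y (k + 1)‖ ^ 2) / (1 - ‖r‖)) / (1 - ‖r‖))
    (fun _ => by positivity) fun n => ?_
  rw [le_div_iff₀ h2]
  have h3 := key n
  have h4 : (∑ k ∈ Finset.range n, ‖y (k + 1)‖ ^ 2) / (1 - ‖r‖) ≤
      (∑' k, ‖y (k + 1)‖ ^ 2) / (1 - ‖r‖) := by
    gcongr
    exact hy'.sum_le_tsum _ (fun _ _ => by positivity)
  have : 0 ≤ ‖u n‖ ^ 2 := by positivity
  linarith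

theorem exists_backward {r : ℂ} (hr : ‖r‖ < 1) {F : ℕ → ℂ} (hF : Memℓp F 2) :
    ∃ y : ℕ → ℂ, Memℓp y 2 ∧ ∀ k, y k = F k + r * y (k + 1) := by
  obtain ⟨B, hB⟩ : ∃ B, ∀ k, ‖F k‖ ≤ B := by
    obtain ⟨B, hB⟩ := hF.tendsto_nat.norm.bddAbove_range
    exact ⟨B, fun k => hB ⟨k, rfl⟩⟩
  have h2 : 0 < 1 - ‖r‖ := by linarith
  have hg := (summable_geometric_of_lt_one (norm_nonneg r) hr).mul_right B
  have hle : ∀ k j, ‖r ^ j * F (k + j)‖ ≤ ‖r‖ ^ j * B := fun k j => by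
    rw [norm_mul, norm_pow]
    gcongr
    exact hB _
  have hs : ∀ k, Summable fun j => r ^ j * F (k + j) := fun k =>
    Summable.of_norm_bounded hg (hle k)
  let y : ℕ → ℂ := fun k => ∑' j, r ^ j * F (k + j)
  have hy : ∀ k, y k = F k + r * y (k + 1) := fun k => by
    simp only [y]
    rw [(hs k).tsum_eq_zero_add, ← tsum_mul_left]
    simp only [pow_zero, one_mul, add_zero]
    congr 1
    refine tsum_congr fun j => ?_
    rw [show k + (j + 1) = k + 1 + j by ring]
    ring
  have hyB : ∀ k, ‖y k‖ ≤ ∑' j, ‖r‖ ^ j * B := fun k => tsum_of_norm_bounded hg.hasSum (hle k)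
  refine ⟨y, ?_, hy⟩
  rw [memℓp_two_iff] at *
  set C := ∑' j, ‖r‖ ^ j * B
  have key : ∀ n, (1 - ‖r‖) * ∑ k ∈ Finset.range n, ‖y k‖ ^ 2 + ‖r‖ * ‖y 0‖ ^ 2 ≤
      ‖r‖ * ‖y n‖ ^ 2 + (∑ k ∈ Finset.range n, ‖F k‖ ^ 2) / (1 - ‖r‖) := by
    intro n
    induction n with
    | zero => simp
    | succ n ih =>
      have := norm_add_mul_sq_le (x := F n) (y := y (n + 1)) hr
      rw [← hy] at this
      rw [Finset.sum_range_succ, Finset.sum_range_succ, add_div]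
      linarith
  refine summable_of_sum_range_le
    (c := (‖r‖ * C ^ 2 + (∑' k, ‖F k‖ ^ 2) / (1 - ‖r‖)) / (1 - ‖r‖))
    (fun _ => by positivity) fun n => ?_
  rw [le_div_iff₀ h2]
  have h3 := key n
  have h4 : (∑ k ∈ Finset.range n, ‖F k‖ ^ 2) / (1 - ‖r‖) ≤
      (∑' k, ‖F k‖ ^ 2) / (1 - ‖r‖) := by
    gcongr
    exact hF.sum_le_tsum _ (fun _ _ => by positivity)
  have h5 : ‖r‖ * ‖y n‖ ^ 2 ≤ ‖r‖ * C ^ 2 := by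
    gcongr
    exact hyB n
  have : 0 ≤ ‖r‖ * ‖y 0‖ ^ 2 := by positivity
  linarith

/-- A half-line discrete Schrödinger equation, with perturbed boundary condition `κ`. -/
theorem exists_halfLine_solution {r κ : ℂ} (hr : ‖r‖ < 1) (hκ : 1 + κ ≠ 0) {F : ℕ → ℂ}
    (hF : Memℓp F 2) :
    ∃ u : ℕ → ℂ, Memℓp u 2 ∧ (1 + r ^ 2 + κ) * u 0 - r * u 1 = F 0 ∧
      ∀ k, (1 + r ^ 2) * u (k + 1) - r * (u k + u (k + 2)) = F (k + 1) := by
  obtain ⟨y, hy, hy1⟩ := exists_backward hr hF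
  obtain ⟨u, hu, hu0, hu1⟩ := exists_forward hr hy
  have hp : Memℓp (fun k => r ^ k : ℕ → ℂ) 2 := by
    rw [memℓp_two_iff]
    have := summable_geometric_of_lt_one (r := ‖r‖ ^ 2) (by positivity)
      (by nlinarith [norm_nonneg r])
    refine this.congr fun k => ?_
    rw [norm_pow]; ring
  refine ⟨fun k => u k + (-(κ * u 0) / (1 + κ)) * r ^ k, hu.add (hp.const_mul _), ?_, fun k => ?_⟩
  · have h1 := hu1 0
    have h2 := hy1 0
    simp only [zero_add] at h1 h2
    field_simp
    linear_combination (1+κ) * (-r * h1 + h2 + hu0)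
  · have h1 := hu1 k
    have h2 := hu1 (k + 1)
    have h3 := hy1 (k + 1)
    simp only [add_assoc, Nat.reduceAdd] at h1 h2 h3
    linear_combination h1 - r * h2 + h3

theorem eq_zero_of_tendsto_of_recurrence {r κ : ℂ} (hr0 : r ≠ 0) (hr : ‖r‖ < 1) (hκ : 1 + κ ≠ 0)
    {u : ℕ → ℂ} (hu : Tendsto u atTop (𝓝 0)) (h0 : (1 + r ^ 2 + κ) * u 0 - r * u 1 = 0)
    (h1 : ∀ k, (1 + r ^ 2) * u (k + 1) - r * (u k + u (k + 2)) = 0) : u = 0 := by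
  have hw : ∀ k, u 1 - r * u 0 = r ^ k * (u (k + 1) - r * u k) := by
    intro k
    induction k with
    | zero => simp
    | succ k ih =>
      rw [ih]
      linear_combination r ^ k * h1 k
  have h10 : u 1 - r * u 0 = 0 := by
    have hl : Tendsto (fun k => r ^ k * (u (k + 1) - r * u k)) atTop (𝓝 (0 * (0 - r * 0))) :=
      (tendsto_pow_atTop_nhds_zero_of_norm_lt_one hr).mul
        (((tendsto_add_atTop_iff_nat 1).2 hu).sub (hu.const_mul r))
    rw [zero_mul] at hl
    exact tendsto_nhds_unique (tendsto_const_nhds.congr hw) hl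
  have hu0 : u 0 = 0 := by
    apply (mul_eq_zero.1 (_ : (1 + κ) * u 0 = 0)).resolve_left hκ
    linear_combination h0 + r * h10
  funext k
  induction k with
  | zero => exact hu0
  | succ k ih =>
    have := hw k
    rw [h10, eq_comm, mul_eq_zero] at this
    have := this.resolve_left (pow_ne_zero _ hr0)
    rw [ih] at this
    simpa using this

theorem eq_zero_of_tendsto_of_elliptic {t : ℝ} (ht : |t| ≤ 2) {u : ℕ → ℂ}
    (hu : Tendsto u atTop (𝓝 0)) (h1 : ∀ k, u k + u (k + 2) = t * u (k + 1)) : u 0 = 0 := by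
  obtain ⟨ht1, ht2⟩ := abs_le.1 ht
  obtain ⟨θ, hθ⟩ : ∃ θ, t = 2 * Real.cos θ :=
    ⟨Real.arccos (t / 2), by rw [Real.cos_arccos] <;> linarith⟩
  have hc : (t : ℂ) = Complex.exp (θ * Complex.I) + Complex.exp (-θ * Complex.I) := by
    rw [hθ]; push_cast; exact Complex.two_cos _
  have hm : Complex.exp (θ * Complex.I) * Complex.exp (-θ * Complex.I) = 1 := by
    rw [← Complex.exp_add]; simp
  have hn1 : ‖Complex.exp (θ * Complex.I)‖ = 1 := Complex.norm_exp_ofReal_mul_I θ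
  have hn2 : ‖Complex.exp (-θ * Complex.I)‖ = 1 := by
    simpa using Complex.norm_exp_ofReal_mul_I (-θ)
  set a := Complex.exp (θ * Complex.I)
  set b := Complex.exp (-θ * Complex.I)
  have hQ : ∀ k, (u (k + 1) - a * u k) * (u (k + 1) - b * u k) =
      (u 1 - a * u 0) * (u 1 - b * u 0) := by
    intro k
    induction k with
    | zero => simp
    | succ k ih =>
      rw [← ih]
      have := h1 k
      rw [hc] at this
      have h3 : u (k + 2) = (a + b) * u (k + 1) - u k := by linear_combination this
      simp only [add_assoc, Nat.reduceAdd, h3]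
      linear_combination (u (k+1) ^ 2 - u k ^2) * hm
  have hQ0 : (u 1 - a * u 0) * (u 1 - b * u 0) = 0 := by
    have hu' := (tendsto_add_atTop_iff_nat 1).2 hu
    have hl := (hu'.sub (hu.const_mul a)).mul (hu'.sub (hu.const_mul b))
    simp only [mul_zero, sub_zero] at hl
    exact tendsto_nhds_unique (tendsto_const_nhds.congr fun k => (hQ k).symm) hl
  have hn : ∀ k, ‖u k‖ = ‖u 0‖ := by
    intro k
    induction k with
    | zero => rfl
    | succ k ih =>
      rw [← ih]
      have := hQ k
      rw [hQ0, mul_eq_zero] at this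
      rcases this with h | h
      · rw [sub_eq_zero.1 h, norm_mul, hn1, one_mul]
      · rw [sub_eq_zero.1 h, norm_mul, hn2, one_mul]
  have := tendsto_nhds_unique (tendsto_const_nhds.congr fun k => (hn k).symm) hu.norm
  simpa using this

/-- The parity-`σ` half-line form of `(𝓛 - l) x = y`, where `u`, `v` are the even and odd
entries of `x` and `a`, `b` those of `y`. -/
def HalfLineEq (s σ l : ℂ) (u v a b : ℕ → ℂ) : Prop :=
  (1 - σ / 2 - l) * u 0 - s * v 0 = a 0 ∧
  (∀ k, (1 - l) * u (k + 1) - 1 / 2 * v k - s * v (k + 1) = a (k + 1)) ∧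
  ∀ k, (3 / 4 - l) * v k - s * u k - 1 / 2 * u (k + 1) = b k

theorem HalfLineEq.rhs_unique {s σ l : ℂ} {u v a b a' b' : ℕ → ℂ}
    (h : HalfLineEq s σ l u v a b) (h' : HalfLineEq s σ l u v a' b') : a = a' ∧ b = b' := by
  constructor
  · funext k
    cases k with
    | zero => exact h.1.symm.trans h'.1
    | succ k => exact (h.2.1 k).symm.trans (h'.2.1 k)
  · funext k
    exact (h.2.2 k).symm.trans (h'.2.2 k)

theorem boundary_ne_zero {s σ l r : ℂ} (hs : s * s = 1 / 8) (hσ : σ = 1 ∨ σ = -1)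
    (hl : l ≠ 3 / 4) (hl' : l ≠ 7 / 4) (hr : ‖r‖ < 1)
    (hD : s * (r ^ 2 + 1) = 2 * ((1 - l) * (3 / 4 - l) - 3 / 8) * r) :
    1 + (4 * r * s - 8 * r * s * σ * (3 / 4 - l)) ≠ 0 := by
  intro h
  have hX : ‖r * s‖ < 1 / 2 := by
    have : ‖s‖ * ‖s‖ = 1 / 8 := by rw [← norm_mul, hs]; simp
    rw [norm_mul]
    nlinarith [norm_nonneg r, norm_nonneg s]
  have hX1 : 2 * (r * s) - 1 ≠ 0 := by
    intro h0
    rw [show r * s = 1 / 2 by linear_combination h0 / 2] at hX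
    norm_num at hX
  have hX2 : 2 * (r * s) + 1 ≠ 0 := by
    intro h0
    rw [show r * s = -(1 / 2) by linear_combination h0 / 2] at hX
    norm_num at hX
  have hE : (r * s) ^ 2 + 1 / 8 = 2 * ((1 - l) * (3 / 4 - l) - 3 / 8) * (r * s) := by
    linear_combination s * hD - hs
  replace h : 1 + (4 * (r * s) - 8 * (r * s) * σ * (3 / 4 - l)) = 0 := by
    linear_combination h
  generalize r * s = X at *
  obtain ⟨m, rfl⟩ : ∃ m, l = 3 / 4 - m := ⟨3 / 4 - l, by ring⟩
  rcases hσ with rfl | rfl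
  · have h1 : 1 + 4 * X - 8 * X * m = 0 := by linear_combination h
    have : (2 * X - 1) * (1 + 4 * X) ^ 2 = 0 := by
      linear_combination 32 * X * hE - h1 * (8 * X * m + 1 + 4 * X + 2 * X)
    have := eq_zero_of_pow_eq_zero ((mul_eq_zero.1 this).resolve_left hX1)
    apply hl
    have hXv : X = -(1 / 4) := by linear_combination this / 4
    rw [hXv] at h1
    linear_combination -h1 / 2
  · have h1 : 1 + 4 * X + 8 * X * m = 0 := by linear_combination h
    have : (2 * X + 1) * ((4 * X - 1) * (4 * X + 1)) = 0 := by
      linear_combination 32 * X * hE + h1 * (8 * X * m - 1 - 4 * X + 2 * X)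
    rcases mul_eq_zero.1 ((mul_eq_zero.1 this).resolve_left hX2) with h2 | h2
    · apply hl'
      have hXv : X = 1 / 4 := by linear_combination h2 / 4
      rw [hXv] at h1
      linear_combination -h1 / 2
    · apply hl
      have hXv : X = -(1 / 4) := by linear_combination h2 / 4
      rw [hXv] at h1
      linear_combination h1 / 2

theorem exists_halfLineEq {s σ l r : ℂ} (hs : s * s = 1 / 8) (hσ : σ = 1 ∨ σ = -1)
    (hl : l ≠ 3 / 4) (hl' : l ≠ 7 / 4) (hr0 : r ≠ 0) (hr : ‖r‖ < 1)
    (hD : s * (r ^ 2 + 1) = 2 * ((1 - l) * (3 / 4 - l) - 3 / 8) * r) {a b : ℕ → ℂ}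
    (ha : Memℓp a 2) (hb : Memℓp b 2) :
    ∃ u v : ℕ → ℂ, Memℓp u 2 ∧ Memℓp v 2 ∧ HalfLineEq s σ l u v a b := by
  have hs0 : s ≠ 0 := by rintro rfl; norm_num at hs
  have hm : 3 / 4 - l ≠ 0 := sub_ne_zero.2 hl.symm
  have hD' : r ^ 2 + 1 = 16 * ((1 - l) * (3 / 4 - l) - 3 / 8) * (r * s) := by
    linear_combination 8 * s * hD - 8 * (r ^ 2 + 1) * hs
  let b' : ℕ → ℂ := fun k => Nat.casesOn k 0 b
  have hb0 : b' 0 = 0 := rfl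
  have hb1 : ∀ k, b' (k + 1) = b k := fun _ => rfl
  have hb' : Memℓp b' 2 := Memℓp.of_nat_succ hb
  obtain ⟨u, hu, hu0, hu1⟩ := exists_halfLine_solution hr
    (boundary_ne_zero hs hσ hl hl' hr hD)
    (((ha.const_mul (3 / 4 - l)).add ((hb.const_mul s).add (hb'.const_mul (1 / 2)))).const_mul
      (16 * r * s))
  obtain ⟨M, hM⟩ : ∃ M, (3 / 4 - l) * M = 1 := ⟨_, mul_inv_cancel₀ hm⟩
  have hq : 16 * r * s * (3 / 4 - l) ≠ 0 := by simp [hr0, hs0, hm]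
  refine ⟨u, fun k => M * (b k + (s * u k + 1 / 2 * u (k + 1))), hu,
    (hb.add ((hu.const_mul s).add (hu.nat_succ.const_mul (1 / 2)))).const_mul _,
    ?_, fun k => ?_, fun k => ?_⟩
  · apply mul_left_cancel₀ hq
    simp only [Pi.add_apply, hb0] at hu0
    simp only [zero_add]
    linear_combination hu0 - u 0 * hD' - (16 * r * s * u 0 + 8 * r * u 1) * hs -
      16 * r * s * s * (b 0 + s * u 0 + u 1 / 2) * hM
  · apply mul_left_cancel₀ hq
    have h1 := hu1 k
    simp only [Pi.add_apply, hb1] at h1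
    simp only [add_assoc, Nat.reduceAdd]
    linear_combination h1 - u (k + 1) * hD' -
      (16 * r * s * u (k + 1) + 8 * r * (u k + u (k + 2))) * hs -
      16 * r * s * (s * (b (k + 1) + s * u (k + 1) + u (k + 2) / 2) +
        (b k + s * u k + u (k + 1) / 2) / 2) * hM
  · linear_combination (b k + s * u k + 1 / 2 * u (k + 1)) * hM

theorem HalfLineEq.eq_zero {s σ l r : ℂ} (hs : s * s = 1 / 8) (hσ : σ = 1 ∨ σ = -1)
    (hl : l ≠ 3 / 4) (hl' : l ≠ 7 / 4) (hr0 : r ≠ 0) (hr : ‖r‖ < 1)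
    (hD : s * (r ^ 2 + 1) = 2 * ((1 - l) * (3 / 4 - l) - 3 / 8) * r) {u v : ℕ → ℂ}
    (hu : Tendsto u atTop (𝓝 0)) (h : HalfLineEq s σ l u v 0 0) : u = 0 ∧ v = 0 := by
  obtain ⟨h0, h1, h2⟩ := h
  simp only [Pi.zero_apply] at h0 h1 h2
  have hD' : r ^ 2 + 1 = 16 * ((1 - l) * (3 / 4 - l) - 3 / 8) * (r * s) := by
    linear_combination 8 * s * hD - 8 * (r ^ 2 + 1) * hs
  have hu0 : u = 0 := by
    refine eq_zero_of_tendsto_of_recurrence hr0 hr (boundary_ne_zero hs hσ hl hl' hr hD) hu ?_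
      fun k => ?_
    · have := h2 0
      simp only [zero_add] at this
      linear_combination 16 * r * s * ((3 / 4 - l) * h0 + s * this)  + u 0 * hD' +
        (16 * r * s * u 0 + 8 * r * u 1) * hs
    · have := h2 k
      have h3 := h2 (k + 1)
      simp only [add_assoc, Nat.reduceAdd] at h3
      linear_combination 16 * r * s * ((3 / 4 - l) * h1 k + s * h3 + 1 / 2 * this) +
        u (k + 1) * hD' + (16 * r * s * u (k + 1) + 8 * r * (u k + u (k + 2))) * hs
  refine ⟨hu0, funext fun k => ?_⟩
  have := h2 k
  simp only [hu0, Pi.zero_apply, mul_zero, sub_zero] at this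
  exact (mul_eq_zero.1 this).resolve_left (sub_ne_zero.2 hl.symm)

theorem not_halfLineEq_of_elliptic {s σ l : ℂ} {t : ℝ} (hs : s * s = 1 / 8) (hl : l ≠ 3 / 4)
    (ht : |t| ≤ 2) (hD : s * t = 2 * ((1 - l) * (3 / 4 - l) - 3 / 8)) {u v a : ℕ → ℂ}
    (hu : Tendsto u atTop (𝓝 0)) (ha0 : a 0 ≠ 0) (ha : ∀ k, a (k + 1) = 0) :
    ¬ HalfLineEq s σ l u v a 0 := by
  rintro ⟨h0, h1, h2⟩
  simp only [Pi.zero_apply] at h2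
  have hrec : ∀ k, u k + u (k + 2) = t * u (k + 1) := fun k => by
    have h3 := h2 k
    have h4 := h2 (k + 1)
    have h5 := h1 k
    rw [ha] at h5
    simp only [add_assoc, Nat.reduceAdd] at h4
    linear_combination -16 * s * ((3 / 4 - l) * h5 + s * h4 + 1 / 2 * h3) -
      8 * s * u (k + 1) * hD + (8 * t * u (k + 1) - 16 * s * u (k + 1) - 8 * (u k + u (k + 2))) * hs
  have hu0 : ∀ n, u n = 0 := fun n => by
    have := eq_zero_of_tendsto_of_elliptic ht (u := fun k => u (k + n))
      ((tendsto_add_atTop_iff_nat n).2 hu) fun k => by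
        have := hrec (k + n)
        rw [show k + 2 + n = k + n + 2 by ring, show k + 1 + n = k + n + 1 by ring]
        exact this
    simpa using this
  have hv0 : v 0 = 0 := by
    have := h2 0
    simp only [hu0, mul_zero, sub_zero] at this
    exact (mul_eq_zero.1 this).resolve_left (sub_ne_zero.2 hl.symm)
  apply ha0
  rw [← h0, hu0, hv0]
  ring

theorem halfLineEq_eigenvector {s σ : ℂ} (hs : s * s = 1 / 8) (hσ : σ = 1 ∨ σ = -1) :
    HalfLineEq s σ (5 / 4 - σ / 2) (fun k => (-2 * s * σ) ^ k)
      (fun k => -2 * s * (-2 * s * σ) ^ k) 0 0 := by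
  have hσ2 : σ * σ = 1 := by rcases hσ with rfl | rfl <;> norm_num
  refine ⟨?_, fun k => ?_, fun k => ?_⟩
  · simp only [pow_zero, Pi.zero_apply]
    linear_combination 2 * hs
  · simp only [Pi.zero_apply, pow_succ]
    generalize (-2 * s * σ) ^ k = z
    linear_combination -(z * s) * hσ2 - (4 * z * s * σ) * hs
  · simp only [Pi.zero_apply, pow_succ]
    ring

theorem mem_bands_of_real {s : ℝ} (hs : s = Real.sqrt 2 / 4) {l : ℂ} {t : ℝ} (ht : |t| ≤ 2)
    (hD : (s : ℂ) * t = 2 * ((1 - l) * (3 / 4 - l) - 3 / 8)) :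
    l ∈ Complex.ofReal ''
      (Set.Icc (7/8 - 1/2 * Real.sqrt (25/16 + Real.sqrt 2))
            (7/4 - (7/8 + 1/2 * Real.sqrt (25/16 - Real.sqrt 2)))
          ∪ {3/4}
          ∪ Set.Icc (7/8 + 1/2 * Real.sqrt (25/16 - Real.sqrt 2))
            (7/4 - (7/8 - 1/2 * Real.sqrt (25/16 + Real.sqrt 2)))
          ∪ {7/4}) := by
  obtain ⟨ht1, ht2⟩ := abs_le.1 ht
  have h2 : Real.sqrt 2 ≤ 25 / 16 := by
    rw [Real.sqrt_le_left (by norm_num)]; norm_num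
  have h0 : 0 ≤ Real.sqrt 2 := Real.sqrt_nonneg 2
  set q := Real.sqrt (25 / 16 + Real.sqrt 2 * t / 2) with hq
  have hlo : Real.sqrt (25 / 16 - Real.sqrt 2) ≤ q := Real.sqrt_le_sqrt (by nlinarith)
  have hhi : q ≤ Real.sqrt (25 / 16 + Real.sqrt 2) := Real.sqrt_le_sqrt (by nlinarith)
  have hq2 : q ^ 2 = 25 / 16 + Real.sqrt 2 * t / 2 := Real.sq_sqrt (by nlinarith)
  have hq2' : (q : ℂ) ^ 2 = 25 / 16 + 2 * (s * t) := by
    have : q ^ 2 = 25 / 16 + 2 * (s * t) := by rw [hq2, hs]; ring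
    simpa using congrArg Complex.ofReal this
  have : (l - 7 / 8 - q / 2) * (l - 7 / 8 + q / 2) = 0 := by
    rw [hD] at hq2'
    linear_combination -hq2' / 4
  rcases mul_eq_zero.1 this with h | h
  · refine ⟨7 / 8 + q / 2, ?_, ?_⟩
    · left; right
      constructor <;> linarith
    · push_cast
      linear_combination -h
  · refine ⟨7 / 8 - q / 2, ?_, ?_⟩
    · left; left; left
      constructor <;> linarith
    · push_cast
      linear_combination -h

theorem exists_real_of_sq_mem {s : ℝ} (hs : s = Real.sqrt 2 / 4) {x : ℝ}
    (h1 : 1 / 4 * (25 / 16 - Real.sqrt 2) ≤ (x - 7 / 8) ^ 2)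
    (h2 : (x - 7 / 8) ^ 2 ≤ 1 / 4 * (25 / 16 + Real.sqrt 2)) :
    (x : ℂ) ≠ 3 / 4 ∧ ∃ t : ℝ, |t| ≤ 2 ∧
      (s : ℂ) * t = 2 * ((1 - (x : ℂ)) * (3 / 4 - x) - 3 / 8) := by
  have h0 : 0 < Real.sqrt 2 := by positivity
  have hsq : Real.sqrt 2 ^ 2 = 2 := Real.sq_sqrt (by norm_num)
  have hs0 : 0 < s := by rw [hs]; positivity
  constructor
  · intro h
    have hx : x = 3 / 4 := by exact_mod_cast (by simpa using h : (x : ℂ) = ((3 / 4 : ℝ) : ℂ))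
    rw [hx] at h1
    nlinarith
  · refine ⟨2 * ((1 - x) * (3 / 4 - x) - 3 / 8) / s, ?_, ?_⟩
    · rw [abs_le, le_div_iff₀ hs0, div_le_iff₀ hs0, hs]
      constructor <;> nlinarith
    · have hs' : (s : ℂ) ≠ 0 := by exact_mod_cast hs0.ne'
      push_cast
      field_simp

theorem exists_real_of_mem_bands {s : ℝ} (hs : s = Real.sqrt 2 / 4) {x : ℝ}
    (hx : x ∈ Set.Icc (7/8 - 1/2 * Real.sqrt (25/16 + Real.sqrt 2))
            (7/4 - (7/8 + 1/2 * Real.sqrt (25/16 - Real.sqrt 2))) ∨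
      x ∈ Set.Icc (7/8 + 1/2 * Real.sqrt (25/16 - Real.sqrt 2))
            (7/4 - (7/8 - 1/2 * Real.sqrt (25/16 + Real.sqrt 2)))) :
    (x : ℂ) ≠ 3 / 4 ∧ ∃ t : ℝ, |t| ≤ 2 ∧
      (s : ℂ) * t = 2 * ((1 - (x : ℂ)) * (3 / 4 - x) - 3 / 8) := by
  have h2 : Real.sqrt 2 ≤ 25 / 16 := by
    rw [Real.sqrt_le_left (by norm_num)]; norm_num
  have hA := Real.sq_sqrt (show 0 ≤ 25 / 16 - Real.sqrt 2 by linarith)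
  have hB := Real.sq_sqrt (show 0 ≤ 25 / 16 + Real.sqrt 2 by positivity)
  have hA0 := Real.sqrt_nonneg (25 / 16 - Real.sqrt 2)
  have hB0 := Real.sqrt_nonneg (25 / 16 + Real.sqrt 2)
  apply exists_real_of_sq_mem hs <;> rcases hx with ⟨h3, h4⟩ | ⟨h3, h4⟩ <;> nlinarith

/-- The sequence with even entries `u` and odd entries `v`. -/
def interleave (u v : ℕ → ℂ) (n : ℕ) : ℂ := if Even n then u (n / 2) else v (n / 2)

@[simp] theorem interleave_even (u v : ℕ → ℂ) (k : ℕ) : interleave u v (2 * k) = u k := by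
  simp [interleave]

@[simp] theorem interleave_odd (u v : ℕ → ℂ) (k : ℕ) : interleave u v (2 * k + 1) = v k := by
  have : (2 * k + 1) / 2 = k := by omega
  simp [interleave, this]

theorem memℓp_interleave {u v : ℕ → ℂ} (hu : Memℓp u 2) (hv : Memℓp v 2) :
    Memℓp (interleave u v) 2 := by
  rw [memℓp_two_iff] at *
  refine (HasSum.even_add_odd (m := ∑' k, ‖u k‖ ^ 2) (m' := ∑' k, ‖v k‖ ^ 2) ?_ ?_).summable
  · simpa using hu.hasSum
  · simpa using hv.hasSum

theorem Memℓp.comp_injective {ι κ : Type*} {f : ι → ℂ} (hf : Memℓp f 2) {e : κ → ι}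
    (he : Function.Injective e) : Memℓp (fun k => f (e k)) 2 := by
  rw [memℓp_two_iff] at *
  exact hf.comp_injective he

/-- The component of parity `σ` of `g` under the reflection `m ↦ -m - 1`. -/
def parityPart (σ : ℂ) (g : ℤ → ℂ) (n : ℕ) : ℂ := g n + σ * g (-n - 1)

theorem memℓp_parityPart (σ : ℂ) {g : ℤ → ℂ} (hg : Memℓp g 2) : Memℓp (parityPart σ g) 2 :=
  (hg.comp_injective Nat.cast_injective).add
    ((hg.comp_injective (e := fun n : ℕ => (-n - 1 : ℤ)) fun a b h => by
      simpa using h).const_mul σ)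

/-- The Hilbert space `ℓ²(ℤ)`. -/
noncomputable abbrev EllTwo := lp (fun _ : ℤ => ℂ) 2

theorem exists_lp_parityPart {p q : ℕ → ℂ} (hp : Memℓp p 2) (hq : Memℓp q 2) :
    ∃ f : EllTwo, parityPart 1 f = p ∧ parityPart (-1) f = q := by
  let g : ℤ → ℂ := fun m =>
    Int.casesOn m (fun n => 1 / 2 * (p n + q n)) (fun n => 1 / 2 * (p n + -1 * q n))
  have hn : ∀ n : ℕ, g (n : ℤ) = 1 / 2 * (p n + q n) := fun n => rfl
  have hn' : ∀ n : ℕ, g (-(n : ℤ) - 1) = 1 / 2 * (p n + -1 * q n) := fun n => by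
    rw [show (-(n : ℤ) - 1) = Int.negSucc n by omega]
  have hg : Memℓp g 2 := by
    rw [memℓp_two_iff]
    refine Summable.of_nat_of_neg_add_one ?_ ?_
    · simp only [hn]
      exact memℓp_two_iff.1 ((hp.add hq).const_mul (1 / 2))
    · have : ∀ n : ℕ, g (-((n : ℤ) + 1)) = 1 / 2 * (p n + -1 * q n) := fun n => by
        rw [← hn', neg_add']
      simp only [this]
      exact memℓp_two_iff.1 ((hp.add (hq.const_mul (-1))).const_mul (1 / 2))
  refine ⟨⟨g, hg⟩, ?_, ?_⟩ <;> funext n <;>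
  · simp only [parityPart, hn, hn']
    ring

theorem eq_of_parityPart_eq {f g : ℤ → ℂ}
    (h : ∀ σ : ℂ, σ = 1 ∨ σ = -1 → parityPart σ f = parityPart σ g) : f = g := by
  have h1 := fun n => congrFun (h 1 (Or.inl rfl)) n
  have h2 := fun n => congrFun (h (-1) (Or.inr rfl)) n
  simp only [parityPart] at h1 h2
  funext m
  rcases m with n | n
  · change f (n : ℤ) = g (n : ℤ)
    linear_combination (h1 n + h2 n) / 2
  · rw [show Int.negSucc n = -(n : ℤ) - 1 by omega]
    linear_combination (h1 n - h2 n) / 2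

theorem eq_of_even_odd_eq {f g : ℕ → ℂ} (h0 : ∀ k, f (2 * k) = g (2 * k))
    (h1 : ∀ k, f (2 * k + 1) = g (2 * k + 1)) : f = g := by
  funext n
  rcases Nat.even_or_odd' n with ⟨k, rfl | rfl⟩
  exacts [h0 k, h1 k]

theorem lprFunC_reflect (g : ℤ → ℂ) (n : ℕ) :
    lprFunC g (-n - 1) = lprFunC (fun m => g (-m - 1)) n := by
  have h : ¬ (0 : ℤ) ≤ -n - 1 := by omega
  simp only [lprFunC, h, if_false, Nat.cast_nonneg, if_true,
    show (-(-(n : ℤ) - 1) - 1) = n by ring, show (-(n : ℤ) - 1 + 1) = -(n - 1) - 1 by ring,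
    show (-(n : ℤ) - 1 - 1) = -(n + 1) - 1 by ring]

theorem lprFunC_even (g : ℤ → ℂ) (k : ℕ) : lprFunC g ((2 * k : ℕ) : ℤ) =
    g (2 * k) - 1 / 2 * g (2 * k - 1) -
      ((1 / (2 * Real.sqrt 2) : ℝ) : ℂ) * g (2 * k + 1) := by
  have : Even (2 * (k : ℤ)) := even_two_mul _
  simp [lprFunC, this]

theorem lprFunC_odd (g : ℤ → ℂ) (k : ℕ) : lprFunC g ((2 * k + 1 : ℕ) : ℤ) =
    3 / 4 * g (2 * k + 1) - ((1 / (2 * Real.sqrt 2) : ℝ) : ℂ) * g (2 * k) -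
      1 / 2 * g (2 * k + 2) := by
  have h : ¬ Even (2 * (k : ℤ) + 1) := by simp
  have h' : (0 : ℤ) ≤ 2 * k + 1 := by omega
  simp [lprFunC, h, h', add_assoc]

theorem halfLineEq_parityPart {σ : ℂ} (hσ : σ = 1 ∨ σ = -1) (l : ℂ) (g : ℤ → ℂ) :
    HalfLineEq ((1 / (2 * Real.sqrt 2) : ℝ) : ℂ) σ l
      (fun k => parityPart σ g (2 * k)) (fun k => parityPart σ g (2 * k + 1))
      (fun k => parityPart σ (fun m => lprFunC g m - l * g m) (2 * k))
      (fun k => parityPart σ (fun m => lprFunC g m - l * g m) (2 * k + 1)) := by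
  have hσ2 : σ * σ = 1 := by rcases hσ with rfl | rfl <;> norm_num
  refine ⟨?_, fun k => ?_, fun k => ?_⟩
  · simp only [parityPart, lprFunC_reflect, lprFunC_even]
    norm_num
    linear_combination (-(1 / 2) * g (-1)) * hσ2
  · simp only [parityPart, lprFunC_reflect, lprFunC_even]
    push_cast
    ring_nf
  · simp only [parityPart, lprFunC_reflect, lprFunC_odd]
    push_cast
    ring_nf

theorem one_div_two_mul_sqrt_two : 1 / (2 * Real.sqrt 2) = Real.sqrt 2 / 4 := by
  have : Real.sqrt 2 * Real.sqrt 2 = 2 := Real.mul_self_sqrt (by norm_num)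
  field_simp
  linarith

theorem ofReal_one_div_two_mul_sqrt_two_mul_self :
    ((1 / (2 * Real.sqrt 2) : ℝ) : ℂ) * ((1 / (2 * Real.sqrt 2) : ℝ) : ℂ) = 1 / 8 := by
  have h : Real.sqrt 2 * Real.sqrt 2 = 2 := Real.mul_self_sqrt (by norm_num)
  have : (1 / (2 * Real.sqrt 2)) * (1 / (2 * Real.sqrt 2)) = 1 / 8 := by
    rw [one_div_two_mul_sqrt_two]
    linarith
  simpa using congrArg Complex.ofReal this

section Operator

variable {T : EllTwo →L[ℂ] EllTwo}

theorem halfLineEq_of_apply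
    (hT : ∀ (f : EllTwo) (m : ℤ), (T f : ∀ _ : ℤ, ℂ) m = lprFunC (fun i => f i) m)
    {σ : ℂ} (hσ : σ = 1 ∨ σ = -1) (l : ℂ) (f : EllTwo) :
    HalfLineEq ((1 / (2 * Real.sqrt 2) : ℝ) : ℂ) σ l
      (fun k => parityPart σ f (2 * k)) (fun k => parityPart σ f (2 * k + 1))
      (fun k => parityPart σ ((T - algebraMap ℂ (EllTwo →L[ℂ] EllTwo) l) f) (2 * k))
      (fun k => parityPart σ ((T - algebraMap ℂ (EllTwo →L[ℂ] EllTwo) l) f) (2 * k + 1)) := by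
  have : (((T - algebraMap ℂ (EllTwo →L[ℂ] EllTwo) l) f : EllTwo) : ∀ _ : ℤ, ℂ) =
      fun m => lprFunC f m - l * (f : ∀ _ : ℤ, ℂ) m := by
    funext m
    rw [← hT f m]
    simp only [Algebra.algebraMap_eq_smul_one]
    rfl
  rw [this]
  exact halfLineEq_parityPart hσ l f

theorem sub_algebraMap_apply_eq
    (hT : ∀ (f : EllTwo) (m : ℤ), (T f : ∀ _ : ℤ, ℂ) m = lprFunC (fun i => f i) m)
    {l : ℂ} {f h : EllTwo}
    (H : ∀ σ : ℂ, σ = 1 ∨ σ = -1 → HalfLineEq ((1 / (2 * Real.sqrt 2) : ℝ) : ℂ) σ l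
      (fun k => parityPart σ f (2 * k)) (fun k => parityPart σ f (2 * k + 1))
      (fun k => parityPart σ h (2 * k)) (fun k => parityPart σ h (2 * k + 1))) :
    (T - algebraMap ℂ (EllTwo →L[ℂ] EllTwo) l) f = h := by
  apply lp.ext
  refine eq_of_parityPart_eq fun σ hσ => ?_
  obtain ⟨h1, h2⟩ := (halfLineEq_of_apply hT hσ l f).rhs_unique (H σ hσ)
  exact eq_of_even_odd_eq (congrFun h1) (congrFun h2)

theorem bijective_sub_algebraMap
    (hT : ∀ (f : EllTwo) (m : ℤ), (T f : ∀ _ : ℤ, ℂ) m = lprFunC (fun i => f i) m)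
    {l : ℂ} (hl : l ≠ 3 / 4) (hl' : l ≠ 7 / 4)
    (hD : ∀ t : ℝ, |t| ≤ 2 →
      ((1 / (2 * Real.sqrt 2) : ℝ) : ℂ) * t ≠ 2 * ((1 - l) * (3 / 4 - l) - 3 / 8)) :
    Function.Bijective (T - algebraMap ℂ (EllTwo →L[ℂ] EllTwo) l) := by
  have hs := ofReal_one_div_two_mul_sqrt_two_mul_self
  have hs0 : ((1 / (2 * Real.sqrt 2) : ℝ) : ℂ) ≠ 0 := by
    intro h0
    rw [h0] at hs
    norm_num at hs
  obtain ⟨r, hr0, hr, hrw⟩ := exists_small_root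
    (2 * ((1 - l) * (3 / 4 - l) - 3 / 8) / ((1 / (2 * Real.sqrt 2) : ℝ) : ℂ)) fun t ht h => by
      rw [div_eq_iff hs0] at h
      exact hD t ht (by rw [h, mul_comm])
  replace hrw : ((1 / (2 * Real.sqrt 2) : ℝ) : ℂ) * (r ^ 2 + 1) =
      2 * ((1 - l) * (3 / 4 - l) - 3 / 8) * r := by
    rw [hrw, ← mul_assoc, mul_div_cancel₀ _ hs0]
  constructor
  · rw [injective_iff_map_eq_zero]
    intro f hf
    apply lp.ext
    refine eq_of_parityPart_eq fun σ hσ => ?_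
    have H := halfLineEq_of_apply hT hσ l f
    rw [hf] at H
    have h0 : ∀ n, parityPart σ (0 : EllTwo) n = 0 := fun n => by
      simp [parityPart]
    simp only [h0] at H
    have hu : Tendsto (fun k => parityPart σ f (2 * k)) atTop (𝓝 0) :=
      ((memℓp_parityPart σ (lp.memℓp f)).comp_injective
        (mul_right_injective₀ two_ne_zero)).tendsto_nat
    obtain ⟨h1, h2⟩ := HalfLineEq.eq_zero hs hσ hl hl' hr0 hr hrw hu H
    refine eq_of_even_odd_eq (fun k => ?_) fun k => ?_
    · rw [h0]
      exact congrFun h1 k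
    · rw [h0]
      exact congrFun h2 k
  · intro h
    have hsol : ∀ σ : ℂ, σ = 1 ∨ σ = -1 → ∃ p : ℕ → ℂ, Memℓp p 2 ∧
        HalfLineEq ((1 / (2 * Real.sqrt 2) : ℝ) : ℂ) σ l
          (fun k => p (2 * k)) (fun k => p (2 * k + 1))
          (fun k => parityPart σ h (2 * k)) (fun k => parityPart σ h (2 * k + 1)) := by
      intro σ hσ
      have hm := memℓp_parityPart σ (lp.memℓp h)
      obtain ⟨u, v, hu, hv, H⟩ := exists_halfLineEq hs hσ hl hl' hr0 hr hrw
        (hm.comp_injective (mul_right_injective₀ two_ne_zero))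
        (hm.comp_injective (e := fun k => 2 * k + 1) fun a b hab => by simpa using hab)
      exact ⟨interleave u v, memℓp_interleave hu hv, by simpa using H⟩
    obtain ⟨p, hp, Hp⟩ := hsol 1 (Or.inl rfl)
    obtain ⟨q, hq, Hq⟩ := hsol (-1) (Or.inr rfl)
    obtain ⟨f, rfl, rfl⟩ := exists_lp_parityPart hp hq
    refine ⟨f, sub_algebraMap_apply_eq hT ?_⟩
    rintro σ (rfl | rfl)
    exacts [Hp, Hq]

theorem not_surjective_sub_algebraMap
    (hT : ∀ (f : EllTwo) (m : ℤ), (T f : ∀ _ : ℤ, ℂ) m = lprFunC (fun i => f i) m)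
    {l : ℂ} (hl : l ≠ 3 / 4) {t : ℝ} (ht : |t| ≤ 2)
    (hD : ((1 / (2 * Real.sqrt 2) : ℝ) : ℂ) * t = 2 * ((1 - l) * (3 / 4 - l) - 3 / 8)) :
    ¬ Function.Surjective (T - algebraMap ℂ (EllTwo →L[ℂ] EllTwo) l) := by
  intro hsurj
  obtain ⟨f, hf⟩ := hsurj (lp.single 2 (0 : ℤ) (1 : ℂ))
  have H := halfLineEq_of_apply hT (Or.inl rfl) l f
  rw [hf] at H
  have h0 : ∀ n, parityPart 1 (lp.single 2 (0 : ℤ) (1 : ℂ) : EllTwo) n =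
      if n = 0 then 1 else 0 := fun n => by
    have : (-(n : ℤ) - 1) ≠ 0 := by omega
    simp [parityPart, lp.single_apply, Pi.single_apply, this]
  simp only [h0, Nat.succ_ne_zero, if_false] at H
  exact not_halfLineEq_of_elliptic ofReal_one_div_two_mul_sqrt_two_mul_self hl ht hD
    (((memℓp_parityPart 1 (lp.memℓp f)).comp_injective
      (mul_right_injective₀ two_ne_zero)).tendsto_nat) (by simp) (by simp) H

theorem not_injective_sub_algebraMap
    (hT : ∀ (f : EllTwo) (m : ℤ), (T f : ∀ _ : ℤ, ℂ) m = lprFunC (fun i => f i) m)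
    {σ : ℂ} (hσ : σ = 1 ∨ σ = -1) :
    ¬ Function.Injective (T - algebraMap ℂ (EllTwo →L[ℂ] EllTwo) (5 / 4 - σ / 2)) := by
  intro hinj
  have hs := ofReal_one_div_two_mul_sqrt_two_mul_self
  have H := halfLineEq_eigenvector hs hσ
  set s := ((1 / (2 * Real.sqrt 2) : ℝ) : ℂ)
  have hu : Memℓp (fun k : ℕ => (-2 * s * σ) ^ k) 2 := by
    rw [memℓp_two_iff]
    have hn : ‖-2 * s * σ‖ ^ 2 = 1 / 2 := by
      rw [← norm_pow, show (-2 * s * σ) ^ 2 = 1 / 2 by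
        rcases hσ with rfl | rfl <;> linear_combination 4 * hs]
      norm_num
    refine (summable_geometric_of_lt_one (r := 1 / 2) (by norm_num) (by norm_num)).congr
      fun k => ?_
    rw [norm_pow, ← hn]
    ring
  set x := interleave (fun k => (-2 * s * σ) ^ k) (fun k => -2 * s * (-2 * s * σ) ^ k) with hx
  have hxm : Memℓp x 2 := memℓp_interleave hu (hu.const_mul _)
  have h0 : ∀ τ n, parityPart τ (0 : EllTwo) n = 0 := fun τ n => by
    simp [parityPart]
  obtain ⟨f, hf, hf'⟩ : ∃ f : EllTwo,
      parityPart σ f = x ∧ parityPart (-σ) f = 0 := by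
    rcases hσ with rfl | rfl
    · exact exists_lp_parityPart hxm zero_memℓp
    · obtain ⟨f, h1, h2⟩ := exists_lp_parityPart zero_memℓp hxm
      exact ⟨f, h2, by rwa [neg_neg]⟩
  have hker : (T - algebraMap ℂ (EllTwo →L[ℂ] EllTwo) (5 / 4 - σ / 2)) f = 0 := by
    refine sub_algebraMap_apply_eq hT fun τ hτ => ?_
    have : τ = σ ∨ τ = -σ := by
      rcases hσ with rfl | rfl <;> rcases hτ with rfl | rfl <;> simp
    rcases this with rfl | rfl
    · simp only [hf, hx, h0, interleave_even, interleave_odd]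
      exact H
    · simp only [hf', h0]
      exact ⟨by simp, by simp, by simp⟩
  have hf0 := hinj (hker.trans (map_zero _).symm)
  have : x 0 = 1 := by simp [hx, interleave]
  rw [← hf, hf0, h0] at this
  exact zero_ne_one this

end Operator

theorem spectrum_of_projected_laplacian
    (T : lp (fun _ : ℤ => ℂ) 2 →L[ℂ] lp (fun _ : ℤ => ℂ) 2)
    (hT : ∀ (f : lp (fun _ : ℤ => ℂ) 2) (m : ℤ),
      (T f : ∀ _ : ℤ, ℂ) m = lprFunC (fun i => (f : ∀ _ : ℤ, ℂ) i) m) :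
    spectrum ℂ T
      = Complex.ofReal ''
        (Set.Icc (7/8 - 1/2 * Real.sqrt (25/16 + Real.sqrt 2))
            (7/4 - (7/8 + 1/2 * Real.sqrt (25/16 - Real.sqrt 2)))
          ∪ {3/4}
          ∪ Set.Icc (7/8 + 1/2 * Real.sqrt (25/16 - Real.sqrt 2))
            (7/4 - (7/8 - 1/2 * Real.sqrt (25/16 + Real.sqrt 2)))
          ∪ {7/4}) := by
  ext l
  rw [spectrum.mem_iff, IsUnit.sub_iff, ContinuousLinearMap.isUnit_iff_bijective]
  constructor
  · intro h
    by_contra hl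
    refine h (bijective_sub_algebraMap hT ?_ ?_ fun t ht hD =>
      hl (mem_bands_of_real one_div_two_mul_sqrt_two ht hD))
    · rintro rfl
      exact hl ⟨3 / 4, by simp, by simp⟩
    · rintro rfl
      exact hl ⟨7 / 4, by simp, by simp⟩
  · rintro ⟨x, ((hx | rfl) | hx) | rfl, rfl⟩ hb
    · obtain ⟨h1, t, ht, hD⟩ := exists_real_of_mem_bands one_div_two_mul_sqrt_two (Or.inl hx)
      exact not_surjective_sub_algebraMap hT h1 ht hD hb.2
    · refine not_injective_sub_algebraMap hT (Or.inl rfl) ?_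
      convert hb.1 using 4
      norm_num
    · obtain ⟨h1, t, ht, hD⟩ := exists_real_of_mem_bands one_div_two_mul_sqrt_two (Or.inr hx)
      exact not_surjective_sub_algebraMap hT h1 ht hD hb.2
    · refine not_injective_sub_algebraMap hT (Or.inr rfl) ?_
      convert hb.1 using 4
      norm_num
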